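/- Let q > 1, T > 0, ξ ∈ C¹([0,T]), F ∈ C¹(ℝ) non-decreasing, and let H₁, H₂ ∈ C²(ℝ) be convex with H := H₁ − H₂ satisfying H(0) = 0, H ≥ α·H₁ for some α ∈ (0,1], and H₁(p) ≥ C₁(|p|^q − C₂) for all p ∈ ℝ, for some C₁ > 0 and C₂ ≥ 0. Let u be a classical solution of du = ∂_x(F(∂_x u)) dt + H(∂_x u) dξ on 𝕋 × [0,T]. Then there exists a constant C depending only on q and α such that, if osc_{0,T}(ξ) > 0, then ∥∂_x u(·,T)∥_{L^q(𝕋)} ≤ C·((C₁ · osc_{0,T}(ξ))^{−1/(q−1)} + C₂^{1/q}). Notably this bound is uniform with respect to the initial condition u(·,0). -/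

import Mathlib

open Set MeasureTheory intervalIntegral

/-- A classical solution of `du = ∂ₓ(F(∂ₓu)) dt + H(∂ₓu) dξ` on `𝕋 × I`, where
`𝕋 = ℝ/ℤ` is realized as `1`-periodic functions of `x ∈ ℝ`: a function `u`,
`C²` in `x` and `C¹` in `t` (on `I`) with `∂ₜ∂ₓu` continuous, with space derivatives
`ux`, `uxx`, time derivative `ut` and mixed derivative `utx`, satisfying
`∂ₜu = ∂ₓ(F(∂ₓu)) + H(∂ₓu)·ξ'(t)` pointwise. -/
structure IsClassicalSolution (I : Set ℝ) (ξ F H : ℝ → ℝ)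
    (u ux uxx ut utx : ℝ → ℝ → ℝ) : Prop where
  periodic : ∀ x t, u (x + 1) t = u x t
  deriv_x : ∀ x : ℝ, ∀ t ∈ I, HasDerivAt (fun y => u y t) (ux x t) x
  deriv_xx : ∀ x : ℝ, ∀ t ∈ I, HasDerivAt (fun y => ux y t) (uxx x t) x
  deriv_t : ∀ x : ℝ, ∀ t ∈ I, HasDerivWithinAt (fun s => u x s) (ut x t) I t
  deriv_tx : ∀ x : ℝ, ∀ t ∈ I, HasDerivWithinAt (fun s => ux x s) (utx x t) I t
  cont_u : ContinuousOn (fun p : ℝ × ℝ => u p.1 p.2) (Set.univ ×ˢ I)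
  cont_ux : ContinuousOn (fun p : ℝ × ℝ => ux p.1 p.2) (Set.univ ×ˢ I)
  cont_uxx : ContinuousOn (fun p : ℝ × ℝ => uxx p.1 p.2) (Set.univ ×ˢ I)
  cont_ut : ContinuousOn (fun p : ℝ × ℝ => ut p.1 p.2) (Set.univ ×ˢ I)
  cont_utx : ContinuousOn (fun p : ℝ × ℝ => utx p.1 p.2) (Set.univ ×ˢ I)
  pde : ∀ x : ℝ, ∀ t ∈ I,
    ut x t = deriv (fun y => F (ux y t)) x + H (ux x t) * deriv ξ t

/-- The oscillation `osc_{s,t}(ξ) = max_{[s,t]} ξ - min_{[s,t]} ξ` of a (continuous)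
function `ξ` on the interval `[s, t]`. -/
noncomputable def oscOn (ξ : ℝ → ℝ) (s t : ℝ) : ℝ :=
  sSup (ξ '' Set.Icc s t) - sInf (ξ '' Set.Icc s t)

/-- A function whose one-sided values to the left of a maximum point have derivative there
must have nonnegative derivative. -/
theorem deriv_nonneg_of_isMaxOn_right_endpoint {g : ℝ → ℝ} {g' a b : ℝ} (hab : a < b)
    (hg : HasDerivWithinAt g g' (Icc a b) b) (hmax : ∀ r ∈ Icc a b, g r ≤ g b) : 0 ≤ g' := by
  have h1 : HasDerivWithinAt g g' (Iio b) b :=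
    (hg.mono Ico_subset_Icc_self).mono_of_mem_nhdsWithin (Ico_mem_nhdsLT hab)
  rw [hasDerivWithinAt_iff_tendsto_slope' (by simp)] at h1
  refine ge_of_tendsto h1 ?_
  filter_upwards [Ico_mem_nhdsLT hab] with r hr
  rw [slope_def_field]
  exact div_nonneg_of_nonpos (by linarith [hmax r ⟨hr.1, hr.2.le⟩]) (by linarith [hr.2])

/-- The second derivative is nonpositive at a global maximum. -/
theorem second_deriv_nonpos_of_forall_le {f f' : ℝ → ℝ} {f'' x₀ : ℝ}
    (hf : ∀ x, HasDerivAt f (f' x) x) (hf' : HasDerivAt f' f'' x₀)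
    (hmax : ∀ x, f x ≤ f x₀) : f' x₀ = 0 ∧ f'' ≤ 0 := by
  have hloc : IsLocalMax f x₀ := Filter.Eventually.of_forall hmax
  have h0 : f' x₀ = 0 := hloc.hasDerivAt_eq_zero (hf x₀)
  refine ⟨h0, ?_⟩
  by_contra! hpos
  have hderiv : deriv f = f' := funext fun x => (hf x).deriv
  have hmin : IsLocalMin f x₀ := isLocalMin_of_deriv_deriv_pos
    (by rw [hderiv, hf'.deriv]; exact hpos) (by rw [hderiv, h0]) (hf x₀).continuousAt
  have hconst : f =ᶠ[nhds x₀] fun _ => f x₀ := by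
    filter_upwards [hmin] with x hx using le_antisymm (hmax x) hx
  have hzero : f' =ᶠ[nhds x₀] fun _ => 0 := by
    have := hconst.deriv
    rw [hderiv] at this
    simpa using this
  have := hf'.unique ((hasDerivAt_const x₀ (0 : ℝ)).congr_of_eventuallyEq hzero)
  exact hpos.ne' this

/-- Weak maximum principle for periodic functions which are nonincreasing in time
at spatial maxima. -/
theorem periodic_maximum_principle {T : ℝ} {u ux uxx ut : ℝ → ℝ → ℝ}
    (hper : ∀ x t, u (x + 1) t = u x t)
    (hx : ∀ x : ℝ, ∀ t ∈ Icc 0 T, HasDerivAt (fun y => u y t) (ux x t) x)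
    (hxx : ∀ x : ℝ, ∀ t ∈ Icc 0 T, HasDerivAt (fun y => ux y t) (uxx x t) x)
    (ht : ∀ x : ℝ, ∀ t ∈ Icc 0 T, HasDerivWithinAt (fun s => u x s) (ut x t) (Icc 0 T) t)
    (hc : ContinuousOn (fun p : ℝ × ℝ => u p.1 p.2) (univ ×ˢ Icc 0 T))
    (hut : ∀ x : ℝ, ∀ t ∈ Icc 0 T, ux x t = 0 → uxx x t ≤ 0 → ut x t ≤ 0)
    {s t M : ℝ} (hs : 0 ≤ s) (hst : s ≤ t) (htT : t ≤ T) (hM : ∀ x, u x s ≤ M) (x : ℝ) :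
    u x t ≤ M := by
  by_contra! hlt
  have hfract : ∀ y r, u (Int.fract y) r = u y r := fun y r => by
    have hp : Function.Periodic (fun z => u z r) 1 := fun z => hper z r
    have := hp.sub_int_mul_eq (x := y) ⌊y⌋
    rwa [mul_one] at this
  have hfmem : ∀ y : ℝ, Int.fract y ∈ Icc (0 : ℝ) 1 :=
    fun y => ⟨Int.fract_nonneg y, (Int.fract_lt_one y).le⟩
  obtain ⟨ε, hε, hεM⟩ : ∃ ε > 0, M < u x t - ε * (t - s) := by
    refine ⟨(u x t - M) / (2 * (t - s + 1)), div_pos (by linarith) (by linarith), ?_⟩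
    have h1 : (u x t - M) / (2 * (t - s + 1)) * (t - s) ≤ (u x t - M) / 2 := by
      rw [div_mul_eq_mul_div, div_le_div_iff₀ (by linarith) (by norm_num)]
      nlinarith
    linarith
  have hcw : ContinuousOn (fun p : ℝ × ℝ => u p.1 p.2 - ε * (p.2 - s))
      (Icc (0 : ℝ) 1 ×ˢ Icc s t) :=
    (hc.mono (prod_mono (subset_univ _) (Icc_subset_Icc hs htT))).sub (by fun_prop)
  obtain ⟨⟨x₀, t₀⟩, ⟨hx₀, ht₀⟩, hmax⟩ := (isCompact_Icc.prod isCompact_Icc).exists_isMaxOn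
    ⟨(Int.fract x, t), hfmem x, hst, le_rfl⟩ hcw
  have hmax' : ∀ y, ∀ r ∈ Icc s t, u y r - ε * (r - s) ≤ u x₀ t₀ - ε * (t₀ - s) :=
    fun y r hr => by
      have := hmax (show (Int.fract y, r) ∈ Icc (0 : ℝ) 1 ×ˢ Icc s t from ⟨hfmem y, hr⟩)
      simpa [hfract] using this
  simp only at hx₀ ht₀
  have ht₀T : t₀ ∈ Icc 0 T := ⟨hs.trans ht₀.1, ht₀.2.trans htT⟩
  have hst₀ : s < t₀ := by
    rcases ht₀.1.eq_or_lt with h | h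
    · have h1 := hmax' x t ⟨hst, le_rfl⟩
      rw [← h] at h1
      linarith [hM x₀]
    · exact h
  obtain ⟨h1, h2⟩ := second_deriv_nonpos_of_forall_le (fun y => hx y t₀ ht₀T) (hxx x₀ t₀ ht₀T)
    (fun y => by linarith [hmax' y t₀ ht₀])
  have h3 : HasDerivWithinAt (fun r => u x₀ r - ε * (r - s)) (ut x₀ t₀ - ε * 1) (Icc s t₀) t₀ :=
    ((ht x₀ t₀ ht₀T).mono (Icc_subset_Icc hs ht₀T.2)).sub
      (((hasDerivAt_id t₀).sub_const s).const_mul ε).hasDerivWithinAt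
  have h4 := deriv_nonneg_of_isMaxOn_right_endpoint hst₀ h3
    (fun r hr => hmax' x₀ r ⟨hr.1, hr.2.trans ht₀.2⟩)
  linarith [hut x₀ t₀ ht₀T h1 h2]

/-- A spatial integral of a function continuous on `ℝ × [0, T]` is continuous in time. -/
theorem continuousOn_integral_of_continuousOn_strip {T a b : ℝ} (hT : 0 ≤ T) {f : ℝ → ℝ → ℝ}
    (hf : ContinuousOn (fun p : ℝ × ℝ => f p.1 p.2) (univ ×ˢ Icc 0 T)) :
    ContinuousOn (fun t => ∫ x in a..b, f x t) (Icc 0 T) := by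
  have h1 : Continuous (fun p : ℝ × ℝ => f p.2 (projIcc 0 T hT p.1)) := by
    have h2 : Continuous (fun p : ℝ × ℝ => (p.2, (projIcc 0 T hT p.1 : ℝ))) := by fun_prop
    exact hf.comp_continuous h2 (fun p => ⟨mem_univ _, (projIcc 0 T hT p.1).2⟩)
  have h3 := intervalIntegral.continuous_parametric_intervalIntegral_of_continuous'
    (μ := volume) (f := fun t x => f x (projIcc 0 T hT t)) h1 a b
  refine h3.continuousOn.congr fun t ht => ?_
  simp [projIcc_of_mem hT ht]

theorem continuous_slice_of_continuousOn_strip {T t : ℝ} (ht : t ∈ Icc 0 T) {f : ℝ → ℝ → ℝ}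
    (hf : ContinuousOn (fun p : ℝ × ℝ => f p.1 p.2) (univ ×ˢ Icc 0 T)) :
    Continuous (fun x => f x t) := by
  have h2 : Continuous (fun x : ℝ => (x, t)) := by fun_prop
  exact hf.comp_continuous h2 (fun p => ⟨mem_univ _, ht⟩)

/-- Differentiation under the integral sign on a space-time strip. -/
theorem hasDerivAt_integral_of_continuousOn_strip {T a b : ℝ} {f f' : ℝ → ℝ → ℝ}
    (hf : ContinuousOn (fun p : ℝ × ℝ => f p.1 p.2) (univ ×ˢ Icc 0 T))
    (hf' : ContinuousOn (fun p : ℝ × ℝ => f' p.1 p.2) (univ ×ˢ Icc 0 T))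
    (hd : ∀ x, ∀ t ∈ Ioo 0 T, HasDerivAt (fun s => f x s) (f' x t) t)
    {t : ℝ} (ht : t ∈ Ioo 0 T) :
    HasDerivAt (fun s => ∫ x in a..b, f x s) (∫ x in a..b, f' x t) t := by
  obtain ⟨B, hB⟩ := (isCompact_uIcc (a := a) (b := b)).prod (isCompact_Icc (a := (0 : ℝ)) (b := T))
    |>.exists_bound_of_continuousOn (hf'.mono (prod_mono (subset_univ _) le_rfl))
  have hnhds : Ioo 0 T ∈ nhds t := Ioo_mem_nhds ht.1 ht.2
  refine (intervalIntegral.hasDerivAt_integral_of_dominated_loc_of_deriv_le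
    (F := fun s x => f x s) (F' := fun s x => f' x s) (bound := fun _ => B) hnhds ?_ ?_ ?_ ?_ ?_ ?_).2
  · filter_upwards [hnhds] with s hs
    exact (continuous_slice_of_continuousOn_strip (Ioo_subset_Icc_self hs) hf).aestronglyMeasurable
  · exact (continuous_slice_of_continuousOn_strip
      (Ioo_subset_Icc_self ht) hf).intervalIntegrable _ _
  · exact (continuous_slice_of_continuousOn_strip
      (Ioo_subset_Icc_self ht) hf').aestronglyMeasurable
  · exact Filter.Eventually.of_forall fun x hx s hs =>
      hB (x, s) ⟨uIoc_subset_uIcc hx, Ioo_subset_Icc_self hs⟩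
  · exact intervalIntegrable_const
  · exact Filter.Eventually.of_forall fun x _ s hs => hd x s hs

/-- For a periodic function, the values exceed the mean by at most the `L^q` norm of the
derivative. -/
theorem le_integral_add_Lq_norm_deriv {q : ℝ} (hq : 1 < q) {f f' : ℝ → ℝ}
    (hper : ∀ x, f (x + 1) = f x) (hf : ∀ x, HasDerivAt f (f' x) x) (hf' : Continuous f') (x : ℝ) :
    f x ≤ (∫ y in (0 : ℝ)..1, f y) + (∫ y in (0 : ℝ)..1, |f' y| ^ q) ^ (1 / q) := by
  have hq0 : 0 < q := by linarith
  have hfc : Continuous f := continuous_iff_continuousAt.2 fun x => (hf x).continuousAt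
  have hfract : f (Int.fract x) = f x := by
    have hp : Function.Periodic f 1 := hper
    have := hp.sub_int_mul_eq (x := x) ⌊x⌋
    rwa [mul_one] at this
  have hxm : Int.fract x ∈ Icc (0 : ℝ) 1 := ⟨Int.fract_nonneg x, (Int.fract_lt_one x).le⟩
  rw [← hfract]
  generalize Int.fract x = z at hxm
  set c := ∫ y in (0 : ℝ)..1, |f' y| with hc
  have hint : ∀ a b, IntervalIntegrable (fun y => |f' y|) volume a b :=
    fun a b => hf'.abs.intervalIntegrable a b
  have hc0 : 0 ≤ c := intervalIntegral.integral_nonneg zero_le_one fun _ _ => abs_nonneg _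
  have h1 : ∀ y ∈ Icc (0 : ℝ) 1, f z - f y ≤ c := by
    intro y hy
    rw [← intervalIntegral.integral_eq_sub_of_hasDerivAt (fun w _ => hf w)
      (hf'.intervalIntegrable y z)]
    refine (le_abs_self _).trans
      ((intervalIntegral.norm_integral_le_abs_integral_norm (f := f')).trans ?_)
    simp only [Real.norm_eq_abs]
    rw [← abs_of_nonneg hc0, hc]
    exact intervalIntegral.abs_integral_mono_interval
      (by rw [uIoc_of_le zero_le_one]
          intro w hw
          rcases le_total y z with h | h
          · rw [uIoc_of_le h] at hw
            exact ⟨hy.1.trans_lt hw.1, hw.2.trans hxm.2⟩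
          · rw [uIoc_of_ge h] at hw
            exact ⟨hxm.1.trans_lt hw.1, hw.2.trans hy.2⟩)
      (Filter.Eventually.of_forall fun _ => abs_nonneg _) (hint 0 1)
  have h2 : f z - c ≤ ∫ y in (0 : ℝ)..1, f y := by
    have := intervalIntegral.integral_mono_on (μ := volume) (f := fun _ => f z - c) (g := f)
      zero_le_one
      intervalIntegrable_const (hfc.intervalIntegrable 0 1) (fun y hy => by linarith [h1 y hy])
    simpa using this
  have h3 : c ^ q ≤ ∫ y in (0 : ℝ)..1, |f' y| ^ q := by
    have hprob : IsProbabilityMeasure (volume.restrict (Ioc (0 : ℝ) 1)) := ⟨by simp⟩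
    rw [hc, intervalIntegral.integral_of_le zero_le_one, intervalIntegral.integral_of_le zero_le_one]
    have hcq : Continuous fun y => |f' y| ^ q :=
      hf'.abs.rpow_const fun _ => Or.inr hq0.le
    exact (convexOn_rpow hq.le).map_integral_le
      (fun y hy => (Real.continuousAt_rpow_const y q (Or.inr hq0.le)).continuousWithinAt)
      isClosed_Ici (Filter.Eventually.of_forall fun y => mem_Ici.2 (abs_nonneg _))
      ((intervalIntegrable_iff_integrableOn_Ioc_of_le zero_le_one).1 (hint 0 1))
      ((intervalIntegrable_iff_integrableOn_Ioc_of_le zero_le_one).1 (hcq.intervalIntegrable 0 1))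
  have h4 : c ≤ (∫ y in (0 : ℝ)..1, |f' y| ^ q) ^ (1 / q) := by
    have := Real.rpow_le_rpow (Real.rpow_nonneg hc0 q) h3 (by positivity : 0 ≤ 1 / q)
    rwa [← Real.rpow_mul hc0, mul_one_div_cancel hq0.ne', Real.rpow_one] at this
  linarith

/-- Along a stretch on which the path `ζ` runs from its minimum to its maximum, a quantity driven by
`ζ'(a - b)` with `a`, `b` nonincreasing has increment at least `(ζ t - ζ s) (a t - b s)`. -/
theorem increment_lower_bound {ζ ζ' a a' b b' m : ℝ → ℝ} {s t : ℝ} (hst : s ≤ t)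
    (hζ : ∀ r ∈ Icc s t, ζ s ≤ ζ r ∧ ζ r ≤ ζ t)
    (hζc : ContinuousOn ζ (Icc s t)) (hac : ContinuousOn a (Icc s t))
    (hbc : ContinuousOn b (Icc s t)) (hmc : ContinuousOn m (Icc s t))
    (hζd : ∀ r ∈ Ioo s t, HasDerivAt ζ (ζ' r) r)
    (had : ∀ r ∈ Ioo s t, HasDerivAt a (a' r) r) (hbd : ∀ r ∈ Ioo s t, HasDerivAt b (b' r) r)
    (hmd : ∀ r ∈ Ioo s t, HasDerivAt m (ζ' r * (a r - b r)) r)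
    (ha' : ∀ r ∈ Ioo s t, a' r ≤ 0) (hb' : ∀ r ∈ Ioo s t, b' r ≤ 0) :
    (ζ t - ζ s) * (a t - b s) ≤ m t - m s := by
  have hd : ∀ r ∈ Ioo s t, HasDerivAt (fun r => m r - (ζ r - ζ s) * a r + (ζ r - ζ t) * b r)
      (-((ζ r - ζ s) * a' r) + (ζ r - ζ t) * b' r) r := fun r hr => by
    have := ((hmd r hr).sub (((hζd r hr).sub_const (ζ s)).mul (had r hr))).add
      (((hζd r hr).sub_const (ζ t)).mul (hbd r hr))
    refine this.congr_deriv ?_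
    ring
  have hmono : MonotoneOn (fun r => m r - (ζ r - ζ s) * a r + (ζ r - ζ t) * b r) (Icc s t) := by
    refine monotoneOn_of_deriv_nonneg (convex_Icc s t) (by fun_prop) ?_ ?_
    · rw [interior_Icc]
      exact fun r hr => (hd r hr).differentiableAt.differentiableWithinAt
    · rw [interior_Icc]
      intro r hr
      rw [(hd r hr).deriv]
      have h := hζ r (Ioo_subset_Icc_self hr)
      have h1 := mul_nonneg (sub_nonneg.2 h.1) (neg_nonneg.2 (ha' r hr))
      have h2 := mul_nonneg (sub_nonneg.2 h.2) (neg_nonneg.2 (hb' r hr))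
      nlinarith
  have := hmono ⟨le_rfl, hst⟩ ⟨hst, le_rfl⟩ hst
  simp only at this
  nlinarith

/-- Below any point `t` and above any intermediate level `v` of a continuous path `ζ` there is a
stretch running from level `v` to a level at least `ζ t`, the path staying between its end
values. -/
theorem exists_stretch {ζ : ℝ → ℝ} {s₀ t v : ℝ} (hst : s₀ ≤ t)
    (hζ : ContinuousOn ζ (Icc s₀ t)) (hv : v ∈ Icc (ζ s₀) (ζ t)) :
    ∃ s t', s₀ ≤ s ∧ s ≤ t' ∧ t' ≤ t ∧ ζ s = v ∧ ζ t ≤ ζ t' ∧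
      ∀ r ∈ Icc s t', ζ s ≤ ζ r ∧ ζ r ≤ ζ t' := by
  have hcomp : IsCompact (Icc s₀ t ∩ ζ ⁻¹' {v}) :=
    isCompact_Icc.of_isClosed_subset (hζ.preimage_isClosed_of_isClosed isClosed_Icc
      isClosed_singleton) inter_subset_left
  obtain ⟨r₀, hr₀, hr₀e⟩ := intermediate_value_Icc hst hζ hv
  obtain ⟨s, ⟨hs, hse⟩, hsmax⟩ := hcomp.exists_isGreatest ⟨r₀, hr₀, hr₀e⟩
  have hse : ζ s = v := hse
  have habove : ∀ r ∈ Icc s t, ζ s ≤ ζ r := by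
    intro r hr
    by_contra! hlt
    obtain ⟨w, hw, hwe⟩ := intermediate_value_Icc hr.2 (hζ.mono (Icc_subset_Icc
      (hs.1.trans hr.1) le_rfl)) (show v ∈ Icc (ζ r) (ζ t) from ⟨hse ▸ hlt.le, hv.2⟩)
    have h1 : w ≤ s := hsmax ⟨⟨hs.1.trans (hr.1.trans hw.1), hw.2⟩, hwe⟩
    have h2 : r = s := le_antisymm (hw.1.trans h1) hr.1
    rw [h2] at hlt
    exact lt_irrefl _ hlt
  obtain ⟨t', ht', htmax⟩ := isCompact_Icc.exists_isMaxOn ⟨t, hs.2, le_rfl⟩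
    (hζ.mono (Icc_subset_Icc hs.1 le_rfl))
  exact ⟨s, t', hs.1, ht'.1, ht'.2, hse, htmax ⟨hs.2, le_rfl⟩, fun r hr =>
    ⟨habove r ⟨hr.1, hr.2.trans ht'.2⟩, htmax ⟨hr.1, hr.2.trans ht'.2⟩⟩⟩

/-- Rearranging a linear quantity bounded by a fractional power of itself. -/
theorem mul_rpow_le_of_mul_le_rpow {q α k N e y : ℝ} (hα0 : 0 < α) (he : 0 < e) (hN : 0 < N)
    (h : e * y * (α / 4 * N) ≤ k * e * N ^ (1 / q)) :
    y * N ^ (1 - 1 / q) ≤ 4 * k / α := by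
  have h1 : N ^ (1 - 1 / q) * N ^ (1 / q) = N := by
    rw [← Real.rpow_add hN]; simp
  have h2 : 0 < N ^ (1 / q) := Real.rpow_pos_of_pos hN _
  rw [le_div_iff₀ hα0]
  refine le_of_mul_le_mul_left (a := e * N ^ (1 / q)) ?_ (mul_pos he h2)
  calc _ = 4 * (e * y * (α / 4 * (N ^ (1 - 1 / q) * N ^ (1 / q)))) := by ring
    _ ≤ 4 * (k * e * N ^ (1 / q)) := by rw [h1]; linarith
    _ = _ := by ring

/-- Decay of a nonnegative nonincreasing quantity which loses a fixed fraction of its size along each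
monotone-like stretch of the path `ζ`. -/
theorem decay_of_stretch_inequality (q α : ℝ) (hq : 1 < q) (hα : α ∈ Ioc (0 : ℝ) 1) :
    ∃ K : ℝ, 0 < K ∧ ∀ (ζ n : ℝ → ℝ) (c s₀ t₀ : ℝ), 0 ≤ c → s₀ ≤ t₀ → ζ s₀ < ζ t₀ →
      ContinuousOn ζ (Icc s₀ t₀) → ContinuousOn n (Icc s₀ t₀) → AntitoneOn n (Icc s₀ t₀) →
      (∀ r ∈ Icc s₀ t₀, 0 ≤ n r) → (∀ r ∈ Icc s₀ t₀, ζ s₀ ≤ ζ r) →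
      (∀ s t, s₀ ≤ s → s ≤ t → t ≤ t₀ → (∀ r ∈ Icc s t, ζ s ≤ ζ r ∧ ζ r ≤ ζ t) →
        (ζ t - ζ s) * (n t - (1 - α) * n s - α * c) ≤ n s ^ (1 / q)) →
      n t₀ ≤ K * ((ζ t₀ - ζ s₀) ^ (-(q / (q - 1))) + c) := by
  obtain ⟨hα0, hα1⟩ := hα
  set β := q / (q - 1) with hβ
  have hβ0 : 0 < β := div_pos (by linarith) (by linarith)
  set ρ := 1 - α / 2 with hρ
  have hρ0 : 0 < ρ := by linarith
  have hρ1 : ρ < 1 := by linarith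
  set l := ρ ^ (1 / β) with hl
  have hl0 : 0 < l := Real.rpow_pos_of_pos hρ0 _
  have hl1 : l < 1 := Real.rpow_lt_one hρ0.le hρ1 (by positivity)
  have hlβ : l ^ β = ρ := by
    rw [hl, ← Real.rpow_mul hρ0.le, one_div_mul_cancel hβ0.ne', Real.rpow_one]
  set k := (1 / ρ) ^ (1 / q) / (1 - l) with hk
  have hk0 : 0 < k := div_pos (Real.rpow_pos_of_pos (by positivity) _) (by linarith)
  set K₀ := (4 * k / α) ^ β with hK₀
  have hK₀0 : 0 < K₀ := Real.rpow_pos_of_pos (by positivity) _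
  refine ⟨4 + K₀, by linarith, ?_⟩
  intro ζ n c s₀ t₀ hc hst hlt hζc hnc hanti hn hmin hP
  have hDpos : 0 < ζ t₀ - ζ s₀ := sub_pos.2 hlt
  have hDβ : 0 < (ζ t₀ - ζ s₀) ^ (-β) := Real.rpow_pos_of_pos hDpos _
  have hφc : ContinuousOn (fun r => (ζ r - ζ s₀) ^ β * n r) (Icc s₀ t₀) :=
    ((hζc.sub continuousOn_const).rpow_const fun _ _ => Or.inr hβ0.le).mul hnc
  obtain ⟨t, ht, hmax⟩ := isCompact_Icc.exists_isMaxOn ⟨t₀, hst, le_rfl⟩ hφc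
  have hmax' : ∀ r ∈ Icc s₀ t₀, (ζ r - ζ s₀) ^ β * n r ≤ (ζ t - ζ s₀) ^ β * n t :=
    fun r hr => hmax hr
  set y := ζ t - ζ s₀ with hy
  have hn_t₀ : n t₀ ≤ n t := hanti ht ⟨hst, le_rfl⟩ ht.2
  have hconcl : y ^ β * n t ≤ K₀ → n t₀ ≤ (4 + K₀) * ((ζ t₀ - ζ s₀) ^ (-β) + c) := by
    intro h
    have h1 := (hmax' t₀ ⟨hst, le_rfl⟩).trans h
    have h2 : n t₀ ≤ K₀ * (ζ t₀ - ζ s₀) ^ (-β) := by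
      rw [Real.rpow_neg hDpos.le, ← div_eq_mul_inv, le_div_iff₀ (Real.rpow_pos_of_pos hDpos _)]
      linarith
    have := mul_nonneg hK₀0.le hc
    linarith
  have hy_nonneg : 0 ≤ y := sub_nonneg.2 (hmin t ht)
  rcases hy_nonneg.eq_or_lt with hy0 | hy0
  · exact hconcl (by rw [← hy0, Real.zero_rpow hβ0.ne']; linarith)
  by_cases hN : n t ≤ 4 * c
  · have := mul_nonneg hK₀0.le hc
    have := mul_pos hK₀0 hDβ
    linarith
  push Not at hN
  have hNpos : 0 < n t := by linarith
  refine hconcl ?_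
  have hly : 0 ≤ l * y := mul_nonneg hl0.le hy0.le
  have hly' : l * y ≤ y := mul_le_of_le_one_left hy0.le hl1.le
  obtain ⟨s, t', hs, hst', ht't, hse, hζt', hbetween⟩ := exists_stretch ht.1
    (hζc.mono (Icc_subset_Icc le_rfl ht.2))
    (show ζ s₀ + l * y ∈ Icc (ζ s₀) (ζ t) from ⟨by linarith, by linarith⟩)
  have hsm : s ∈ Icc s₀ t₀ := ⟨hs, hst'.trans (ht't.trans ht.2)⟩
  have hstretch := hP s t' hs hst' (ht't.trans ht.2) hbetween
  have hnt' : n t ≤ n t' := hanti ⟨hs.trans hst', ht't.trans ht.2⟩ ht ht't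
  have hns : n s ≤ n t / ρ := by
    have h1 := hmax' s hsm
    rw [hse, add_sub_cancel_left, Real.mul_rpow hl0.le hy0.le, hlβ] at h1
    rw [le_div_iff₀ hρ0]
    refine le_of_mul_le_mul_left (a := y ^ β) ?_ (Real.rpow_pos_of_pos hy0 β)
    linarith
  have hjump : (1 - l) * y ≤ ζ t' - ζ s := by
    rw [hse]
    linarith
  have hfrac : (1 - α) * n s ≤ ρ * n t := by
    have h1 : (1 - α) * n s ≤ (1 - α) * (n t / ρ) :=
      mul_le_mul_of_nonneg_left hns (by linarith)
    have h2 : (1 - α) * (n t / ρ) ≤ ρ * n t := by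
      rw [← mul_div_assoc, div_le_iff₀ hρ0]
      have h3 : 1 - α ≤ ρ * ρ := by rw [hρ]; nlinarith [sq_nonneg α]
      linarith [mul_le_mul_of_nonneg_right h3 hNpos.le]
    linarith
  have hgap : α / 4 * n t ≤ n t' - (1 - α) * n s - α * c := by
    have h1 : α * (4 * c) ≤ α * n t := mul_le_mul_of_nonneg_left hN.le hα0.le
    have h2 : ρ * n t = n t - α / 2 * n t := by rw [hρ]; ring
    linarith
  have hroot : n s ^ (1 / q) ≤ (1 / ρ) ^ (1 / q) * n t ^ (1 / q) := by
    rw [← Real.mul_rpow (by positivity) hNpos.le]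
    exact Real.rpow_le_rpow (hn s hsm) (by rw [one_div_mul_eq_div]; exact hns) (by positivity)
  have hmain : (1 - l) * y * (α / 4 * n t) ≤ (1 / ρ) ^ (1 / q) * n t ^ (1 / q) :=
    (mul_le_mul hjump hgap (by positivity) (by linarith)).trans (hstretch.trans hroot)
  have hlast : y * n t ^ (1 - 1 / q) ≤ 4 * k / α := by
    refine mul_rpow_le_of_mul_le_rpow hα0 (sub_pos.2 hl1) hNpos ?_
    rwa [hk, div_mul_cancel₀ _ (sub_pos.2 hl1).ne']
  have hpow := Real.rpow_le_rpow (by positivity) hlast hβ0.le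
  rw [Real.mul_rpow hy0.le (by positivity), ← Real.rpow_mul hNpos.le] at hpow
  have hexp : (1 - 1 / q) * β = 1 := by
    rw [hβ]; field_simp [show q - 1 ≠ 0 by linarith]
  rwa [hexp, Real.rpow_one] at hpow

namespace IsClassicalSolution

variable {T : ℝ} {ξ F H : ℝ → ℝ} {u ux uxx ut utx : ℝ → ℝ → ℝ}

theorem hasDerivAt_time (h : IsClassicalSolution (Icc 0 T) ξ F H u ux uxx ut utx) (x : ℝ) {t : ℝ}
    (ht : t ∈ Ioo 0 T) : HasDerivAt (fun s => u x s) (ut x t) t :=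
  (h.deriv_t x t (Ioo_subset_Icc_self ht)).hasDerivAt (Icc_mem_nhds ht.1 ht.2)

theorem hasDerivAt_ux_time (h : IsClassicalSolution (Icc 0 T) ξ F H u ux uxx ut utx) (x : ℝ)
    {t : ℝ} (ht : t ∈ Ioo 0 T) : HasDerivAt (fun s => ux x s) (utx x t) t :=
  (h.deriv_tx x t (Ioo_subset_Icc_self ht)).hasDerivAt (Icc_mem_nhds ht.1 ht.2)

theorem ux_periodic (h : IsClassicalSolution (Icc 0 T) ξ F H u ux uxx ut utx) (x : ℝ) {t : ℝ}
    (ht : t ∈ Icc 0 T) : ux (x + 1) t = ux x t := by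
  have h1 : HasDerivAt (fun y => u (y + 1) t) (ux (x + 1) t) x :=
    (h.deriv_x (x + 1) t ht).comp_add_const x 1
  simp only [h.periodic] at h1
  exact h1.unique (h.deriv_x x t ht)

theorem ut_periodic (h : IsClassicalSolution (Icc 0 T) ξ F H u ux uxx ut utx) (x : ℝ) {t : ℝ}
    (ht : t ∈ Ioo 0 T) : ut (x + 1) t = ut x t := by
  have h1 := h.hasDerivAt_time (x + 1) ht
  simp only [h.periodic] at h1
  exact h1.unique (h.hasDerivAt_time x ht)

/-- The mixed derivatives agree: `utx` is also the space derivative of `ut`. -/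
theorem hasDerivAt_ut (h : IsClassicalSolution (Icc 0 T) ξ F H u ux uxx ut utx) (x : ℝ) {t : ℝ}
    (ht : t ∈ Ioo 0 T) : HasDerivAt (fun y => ut y t) (utx x t) x := by
  have hcont := continuous_slice_of_continuousOn_strip (Ioo_subset_Icc_self ht) h.cont_utx
  have hprim : ∀ y, ut y t = ut 0 t + ∫ z in (0 : ℝ)..y, utx z t := by
    intro y
    have h1 := hasDerivAt_integral_of_continuousOn_strip (a := 0) (b := y) h.cont_ux h.cont_utx
      (fun z s hs => h.hasDerivAt_ux_time z hs) ht
    have h2 : (fun s => ∫ z in (0 : ℝ)..y, ux z s) =ᶠ[nhds t] fun s => u y s - u 0 s := by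
      filter_upwards [Ioo_mem_nhds ht.1 ht.2] with s hs
      have hs' := Ioo_subset_Icc_self hs
      exact intervalIntegral.integral_eq_sub_of_hasDerivAt (fun w _ => h.deriv_x w s hs')
        ((continuous_slice_of_continuousOn_strip hs' h.cont_ux).intervalIntegrable _ _)
    have h3 := (h1.congr_of_eventuallyEq h2.symm).unique
      ((h.hasDerivAt_time y ht).sub (h.hasDerivAt_time 0 ht))
    linarith
  have h4 : HasDerivAt (fun y => ut 0 t + ∫ z in (0 : ℝ)..y, utx z t) (utx x t) x :=
    (hcont.integral_hasStrictDerivAt 0 x).hasDerivAt.const_add _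
  exact h4.congr_of_eventuallyEq (Filter.Eventually.of_forall hprim)

theorem hasDerivAt_comp_ux (h : IsClassicalSolution (Icc 0 T) ξ F H u ux uxx ut utx)
    {G : ℝ → ℝ} (hG : Differentiable ℝ G) (x : ℝ) {t : ℝ} (ht : t ∈ Icc 0 T) :
    HasDerivAt (fun y => G (ux y t)) (deriv G (ux x t) * uxx x t) x :=
  (hG (ux x t)).hasDerivAt.comp x (h.deriv_xx x t ht)

theorem ut_eq (h : IsClassicalSolution (Icc 0 T) ξ F H u ux uxx ut utx)
    (hF : Differentiable ℝ F) (x : ℝ) {t : ℝ} (ht : t ∈ Icc 0 T) :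
    ut x t = deriv F (ux x t) * uxx x t + H (ux x t) * deriv ξ t := by
  rw [h.pde x t ht, (h.hasDerivAt_comp_ux hF x ht).deriv]

/-- A total space derivative of a function of `ux` integrates to zero over a period. -/
theorem integral_mul_uxx_eq_zero (h : IsClassicalSolution (Icc 0 T) ξ F H u ux uxx ut utx)
    {g : ℝ → ℝ} (hg : Continuous g) {t : ℝ} (ht : t ∈ Icc 0 T) :
    ∫ x in (0 : ℝ)..1, g (ux x t) * uxx x t = 0 := by
  have hcx := continuous_slice_of_continuousOn_strip ht h.cont_ux
  have hcxx := continuous_slice_of_continuousOn_strip ht h.cont_uxx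
  have hprim : ∀ p, HasDerivAt (fun p => ∫ z in (0 : ℝ)..p, g z) (g p) p :=
    fun p => (hg.integral_hasStrictDerivAt 0 p).hasDerivAt
  have hchain : ∀ x, HasDerivAt (fun x => ∫ z in (0 : ℝ)..ux x t, g z) (g (ux x t) * uxx x t) x :=
    fun x => HasDerivAt.comp (h₂ := fun p => ∫ z in (0 : ℝ)..p, g z) x (hprim (ux x t))
      (h.deriv_xx x t ht)
  rw [intervalIntegral.integral_eq_sub_of_hasDerivAt (fun x _ => hchain x)
    (((hg.comp hcx).mul hcxx).intervalIntegrable _ _)]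
  have := h.ux_periodic 0 ht
  rw [zero_add] at this
  rw [this, sub_self]

/-- The dissipation identity makes integrals of convex functions of `ux` nonincreasing. -/
theorem integral_deriv_mul_utx_nonpos (h : IsClassicalSolution (Icc 0 T) ξ F H u ux uxx ut utx)
    (hF : ContDiff ℝ 1 F) (hFm : Monotone F) (hH : Continuous H) {G : ℝ → ℝ}
    (hG : ContDiff ℝ 2 G) (hGc : ConvexOn ℝ univ G) {t : ℝ} (ht : t ∈ Ioo 0 T) :
    ∫ x in (0 : ℝ)..1, deriv G (ux x t) * utx x t ≤ 0 := by
  have ht' := Ioo_subset_Icc_self ht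
  have hG' : ContDiff ℝ 1 (deriv G) := hG.deriv'
  have hG'' : Continuous (deriv (deriv G)) := hG'.continuous_deriv_one
  have hGd : Differentiable ℝ G := hG.differentiable (by norm_num)
  have hG'd : Differentiable ℝ (deriv G) := hG'.differentiable (by norm_num)
  have hG''nn : ∀ p, 0 ≤ deriv (deriv G) p := fun p =>
    Monotone.deriv_nonneg (monotoneOn_univ.1 (hGc.monotoneOn_deriv fun x _ => hGd x))
  have hF' : Continuous (deriv F) := hF.continuous_deriv_one
  have hcx := continuous_slice_of_continuousOn_strip ht' h.cont_ux
  have hcxx := continuous_slice_of_continuousOn_strip ht' h.cont_uxx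
  have hctx := continuous_slice_of_continuousOn_strip ht' h.cont_utx
  rw [intervalIntegral.integral_mul_deriv_eq_deriv_mul
    (u := fun x => deriv G (ux x t)) (v := fun x => ut x t)
    (fun x _ => h.hasDerivAt_comp_ux hG'd x ht') (fun x _ => h.hasDerivAt_ut x ht)
    (((hG''.comp hcx).mul hcxx).intervalIntegrable _ _) (hctx.intervalIntegrable _ _)]
  have hb1 := h.ux_periodic 0 ht'
  have hb2 := h.ut_periodic 0 ht
  rw [zero_add] at hb1 hb2
  rw [hb1, hb2, sub_self, zero_sub, neg_nonpos]
  have hsplit : ∀ x, deriv (deriv G) (ux x t) * uxx x t * ut x t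
      = deriv (deriv G) (ux x t) * deriv F (ux x t) * uxx x t ^ 2
        + deriv ξ t * ((deriv (deriv G) (ux x t) * H (ux x t)) * uxx x t) := fun x => by
    rw [h.ut_eq (hF.differentiable (by norm_num)) x ht']
    ring
  have hint1 : IntervalIntegrable (fun x => deriv (deriv G) (ux x t) * deriv F (ux x t)
      * uxx x t ^ 2) volume 0 1 :=
    (((hG''.comp hcx).mul (hF'.comp hcx)).mul (hcxx.pow 2)).intervalIntegrable _ _
  have hint2 : IntervalIntegrable (fun x => deriv ξ t * ((deriv (deriv G) (ux x t) * H (ux x t))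
      * uxx x t)) volume 0 1 :=
    (continuous_const.mul (((hG''.comp hcx).mul (hH.comp hcx)).mul hcxx)).intervalIntegrable _ _
  simp only [hsplit]
  rw [intervalIntegral.integral_add hint1 hint2, intervalIntegral.integral_const_mul,
    h.integral_mul_uxx_eq_zero (g := fun p => deriv (deriv G) p * H p) (hG''.mul hH) ht', mul_zero,
    add_zero]
  exact intervalIntegral.integral_nonneg zero_le_one fun x _ =>
    mul_nonneg (mul_nonneg (hG''nn _) hFm.deriv_nonneg) (sq_nonneg _)

theorem hasDerivAt_integral_comp_ux (h : IsClassicalSolution (Icc 0 T) ξ F H u ux uxx ut utx)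
    {G : ℝ → ℝ} (hG : ContDiff ℝ 1 G) {t : ℝ} (ht : t ∈ Ioo 0 T) :
    HasDerivAt (fun s => ∫ x in (0 : ℝ)..1, G (ux x s))
      (∫ x in (0 : ℝ)..1, deriv G (ux x t) * utx x t) t :=
  hasDerivAt_integral_of_continuousOn_strip (f := fun x s => G (ux x s))
    (f' := fun x s => deriv G (ux x s) * utx x s)
    (hG.continuous.comp_continuousOn h.cont_ux)
    ((hG.continuous_deriv_one.comp_continuousOn h.cont_ux).mul h.cont_utx)
    (fun x s hs => ((hG.differentiable (by norm_num)) (ux x s)).hasDerivAt.comp s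
      (h.hasDerivAt_ux_time x hs)) ht

theorem continuousOn_integral_comp_ux (h : IsClassicalSolution (Icc 0 T) ξ F H u ux uxx ut utx)
    (hT : 0 ≤ T) {G : ℝ → ℝ} (hG : Continuous G) :
    ContinuousOn (fun s => ∫ x in (0 : ℝ)..1, G (ux x s)) (Icc 0 T) :=
  continuousOn_integral_of_continuousOn_strip (f := fun x s => G (ux x s)) hT
    (hG.comp_continuousOn h.cont_ux)

theorem antitoneOn_integral_comp_ux (h : IsClassicalSolution (Icc 0 T) ξ F H u ux uxx ut utx)
    (hT : 0 ≤ T) (hF : ContDiff ℝ 1 F) (hFm : Monotone F) (hH : Continuous H) {G : ℝ → ℝ}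
    (hG : ContDiff ℝ 2 G) (hGc : ConvexOn ℝ univ G) :
    AntitoneOn (fun s => ∫ x in (0 : ℝ)..1, G (ux x s)) (Icc 0 T) := by
  have hG1 : ContDiff ℝ 1 G := hG.of_le (by norm_num)
  refine antitoneOn_of_deriv_nonpos (convex_Icc 0 T)
    (h.continuousOn_integral_comp_ux hT hG.continuous) ?_ ?_ <;> rw [interior_Icc]
  · exact fun t ht => (h.hasDerivAt_integral_comp_ux hG1 ht).differentiableAt.differentiableWithinAt
  · intro t ht
    rw [(h.hasDerivAt_integral_comp_ux hG1 ht).deriv]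
    exact h.integral_deriv_mul_utx_nonpos hF hFm hH hG hGc ht

theorem hasDerivAt_mean (h : IsClassicalSolution (Icc 0 T) ξ F H u ux uxx ut utx)
    (hF : ContDiff ℝ 1 F) (hH : Continuous H) {t : ℝ} (ht : t ∈ Ioo 0 T) :
    HasDerivAt (fun s => ∫ x in (0 : ℝ)..1, u x s)
      (deriv ξ t * ∫ x in (0 : ℝ)..1, H (ux x t)) t := by
  have ht' := Ioo_subset_Icc_self ht
  have hcx := continuous_slice_of_continuousOn_strip ht' h.cont_ux
  have hcxx := continuous_slice_of_continuousOn_strip ht' h.cont_uxx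
  refine (hasDerivAt_integral_of_continuousOn_strip h.cont_u h.cont_ut
    (fun x s hs => h.hasDerivAt_time x hs) ht).congr_deriv ?_
  have hF' : Continuous (deriv F) := hF.continuous_deriv_one
  simp only [h.ut_eq (hF.differentiable (by norm_num)) _ ht']
  have hint1 : IntervalIntegrable (fun x => deriv F (ux x t) * uxx x t) volume 0 1 :=
    ((hF'.comp hcx).mul hcxx).intervalIntegrable _ _
  have hint2 : IntervalIntegrable (fun x => H (ux x t) * deriv ξ t) volume 0 1 :=
    ((hH.comp hcx).mul continuous_const).intervalIntegrable _ _
  rw [intervalIntegral.integral_add hint1 hint2,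
    h.integral_mul_uxx_eq_zero hF' ht', intervalIntegral.integral_mul_const, zero_add, mul_comm]

/-- The mean of `u` moves by at most the `L^q` norm of the gradient at the initial time, as the
extrema of `u` cannot expand. -/
theorem abs_mean_sub_le (h : IsClassicalSolution (Icc 0 T) ξ F H u ux uxx ut utx)
    (hF : ContDiff ℝ 1 F) (hFm : Monotone F) (hH0 : H 0 = 0) {q : ℝ} (hq : 1 < q) {s t : ℝ}
    (hs : 0 ≤ s) (hst : s ≤ t) (htT : t ≤ T) :
    |(∫ x in (0 : ℝ)..1, u x t) - ∫ x in (0 : ℝ)..1, u x s|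
      ≤ (∫ x in (0 : ℝ)..1, |ux x s| ^ q) ^ (1 / q) := by
  have hsI : s ∈ Icc 0 T := ⟨hs, hst.trans htT⟩
  have htI : t ∈ Icc 0 T := ⟨hs.trans hst, htT⟩
  have hcs := continuous_slice_of_continuousOn_strip hsI h.cont_ux
  have hut : ∀ x : ℝ, ∀ t ∈ Icc 0 T, ux x t = 0 →
      ut x t = deriv F 0 * uxx x t := fun x t ht h0 => by
    rw [h.ut_eq (hF.differentiable (by norm_num)) x ht, h0, hH0, zero_mul, add_zero]
  have hF0 : 0 ≤ deriv F 0 := hFm.deriv_nonneg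
  have hint := (continuous_slice_of_continuousOn_strip htI h.cont_u).intervalIntegrable
    (μ := volume) 0 1
  have hup := periodic_maximum_principle h.periodic h.deriv_x h.deriv_xx h.deriv_t h.cont_u
    (fun x t ht h0 h1 => by
      rw [hut x t ht h0]; exact mul_nonpos_of_nonneg_of_nonpos hF0 h1) hs hst htT
    (le_integral_add_Lq_norm_deriv hq (fun x => h.periodic x s) (fun x => h.deriv_x x s hsI) hcs)
  have hdown := periodic_maximum_principle (u := fun x t => -u x t) (ux := fun x t => -ux x t)
    (uxx := fun x t => -uxx x t) (ut := fun x t => -ut x t)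
    (fun x t => by simp only [h.periodic]) (fun x t ht => (h.deriv_x x t ht).neg)
    (fun x t ht => (h.deriv_xx x t ht).neg) (fun x t ht => (h.deriv_t x t ht).neg) h.cont_u.neg
    (fun x t ht h0 h1 => by
      rw [hut x t ht (neg_eq_zero.1 h0), ← mul_neg]
      exact mul_nonpos_of_nonneg_of_nonpos hF0 h1) hs hst htT
    (le_integral_add_Lq_norm_deriv hq (fun x => by simp only [h.periodic])
      (fun x => (h.deriv_x x s hsI).neg) hcs.neg)
  simp only [intervalIntegral.integral_neg, abs_neg] at hdown
  have h1 := intervalIntegral.integral_mono_on (μ := volume) zero_le_one hint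
    intervalIntegrable_const fun x _ => hup x
  have h2 := intervalIntegral.integral_mono_on (μ := volume) zero_le_one hint.neg
    intervalIntegrable_const fun x _ => hdown x
  simp only [intervalIntegral.integral_const, sub_zero, one_smul] at h1 h2
  have h3 : (∫ x in (0 : ℝ)..1, (-fun x => u x t) x) = -∫ x in (0 : ℝ)..1, u x t :=
    intervalIntegral.integral_neg
  rw [h3] at h2
  rw [abs_le]
  constructor <;> linarith

/-- The stretch inequality for the convex energies of `ux`, for the driving path `e C₁ ξ` with
`e = ±1`. -/
theorem stretch_inequality {H₁ H₂ : ℝ → ℝ} {q α C₁ C₂ e : ℝ}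
    (h : IsClassicalSolution (Icc 0 T) ξ F (fun p => H₁ p - H₂ p) u ux uxx ut utx)
    (hT : 0 ≤ T) (hξ : ContDiff ℝ 1 ξ) (hF : ContDiff ℝ 1 F) (hFm : Monotone F)
    (hH₁ : ContDiff ℝ 2 H₁) (hH₂ : ContDiff ℝ 2 H₂) (hc₁ : ConvexOn ℝ univ H₁)
    (hc₂ : ConvexOn ℝ univ H₂) (h0 : H₁ 0 - H₂ 0 = 0) (hα : ∀ p, α * H₁ p ≤ H₁ p - H₂ p)
    (hq : 1 < q) (hC₁ : 0 < C₁) (he : |e| = 1)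
    (hle : ∀ t ∈ Icc 0 T,
      ∫ x in (0 : ℝ)..1, |ux x t| ^ q ≤ (∫ x in (0 : ℝ)..1, H₁ (ux x t)) / C₁ + C₂)
    {s t : ℝ} (hs : 0 ≤ s) (hst : s ≤ t) (htT : t ≤ T)
    (hstr : ∀ r ∈ Icc s t, e * C₁ * ξ s ≤ e * C₁ * ξ r ∧ e * C₁ * ξ r ≤ e * C₁ * ξ t) :
    (e * C₁ * ξ t - e * C₁ * ξ s) * (((∫ x in (0 : ℝ)..1, H₁ (ux x t)) / C₁ + C₂)
      - (1 - α) * ((∫ x in (0 : ℝ)..1, H₁ (ux x s)) / C₁ + C₂) - α * C₂)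
      ≤ ((∫ x in (0 : ℝ)..1, H₁ (ux x s)) / C₁ + C₂) ^ (1 / q) := by
  have hsI : s ∈ Icc 0 T := ⟨hs, hst.trans htT⟩
  have hsub : Icc s t ⊆ Icc 0 T := Icc_subset_Icc hs htT
  have hsub' : Ioo s t ⊆ Ioo 0 T := Ioo_subset_Ioo hs htT
  have hHc : Continuous fun p => H₁ p - H₂ p := hH₁.continuous.sub hH₂.continuous
  have hcx : ∀ r ∈ Icc 0 T, Continuous fun x => ux x r :=
    fun r hr => continuous_slice_of_continuousOn_strip hr h.cont_ux
  have hi₁ : ∀ r ∈ Icc 0 T, IntervalIntegrable (fun x => H₁ (ux x r)) volume 0 1 :=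
    fun r hr => (hH₁.continuous.comp (hcx r hr)).intervalIntegrable _ _
  have hi₂ : ∀ r ∈ Icc 0 T, IntervalIntegrable (fun x => H₂ (ux x r)) volume 0 1 :=
    fun r hr => (hH₂.continuous.comp (hcx r hr)).intervalIntegrable _ _
  have key := increment_lower_bound (ζ := fun r => e * C₁ * ξ r)
    (ζ' := fun r => e * C₁ * deriv ξ r)
    (a := fun r => (∫ x in (0 : ℝ)..1, H₁ (ux x r)) / C₁)
    (a' := fun r => (∫ x in (0 : ℝ)..1, deriv H₁ (ux x r) * utx x r) / C₁)
    (b := fun r => (∫ x in (0 : ℝ)..1, H₂ (ux x r)) / C₁)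
    (b' := fun r => (∫ x in (0 : ℝ)..1, deriv H₂ (ux x r) * utx x r) / C₁)
    (m := fun r => e * ∫ x in (0 : ℝ)..1, u x r) hst hstr
    (continuous_const.mul hξ.continuous).continuousOn
    (((h.continuousOn_integral_comp_ux hT hH₁.continuous).mono hsub).div_const _)
    (((h.continuousOn_integral_comp_ux hT hH₂.continuous).mono hsub).div_const _)
    (continuousOn_const.mul ((continuousOn_integral_of_continuousOn_strip hT h.cont_u).mono hsub))
    (fun r _ => (hξ.differentiable (by norm_num) r).hasDerivAt.const_mul _)
    (fun r hr => (h.hasDerivAt_integral_comp_ux (hH₁.of_le (by norm_num)) (hsub' hr)).div_const _)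
    (fun r hr => (h.hasDerivAt_integral_comp_ux (hH₂.of_le (by norm_num)) (hsub' hr)).div_const _)
    (fun r hr => by
      refine ((h.hasDerivAt_mean hF hHc (hsub' hr)).const_mul e).congr_deriv ?_
      have hr' := Ioo_subset_Icc_self (hsub' hr)
      rw [intervalIntegral.integral_sub (hi₁ r hr') (hi₂ r hr')]
      field_simp)
    (fun r hr => div_nonpos_of_nonpos_of_nonneg
      (h.integral_deriv_mul_utx_nonpos hF hFm hHc hH₁ hc₁ (hsub' hr)) hC₁.le)
    (fun r hr => div_nonpos_of_nonpos_of_nonneg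
      (h.integral_deriv_mul_utx_nonpos hF hFm hHc hH₂ hc₂ (hsub' hr)) hC₁.le)
  have hb : (∫ x in (0 : ℝ)..1, H₂ (ux x s)) / C₁
      ≤ (1 - α) * ((∫ x in (0 : ℝ)..1, H₁ (ux x s)) / C₁) := by
    rw [← mul_div_assoc, ← intervalIntegral.integral_const_mul]
    refine div_le_div_of_nonneg_right ?_ hC₁.le
    exact intervalIntegral.integral_mono_on zero_le_one (hi₂ s hsI) ((hi₁ s hsI).const_mul _)
      fun x _ => by linarith [hα (ux x s)]
  have hmean : e * (∫ x in (0 : ℝ)..1, u x t) - e * ∫ x in (0 : ℝ)..1, u x s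
      ≤ (∫ x in (0 : ℝ)..1, |ux x s| ^ q) ^ (1 / q) := by
    refine le_trans ?_ (h.abs_mean_sub_le hF hFm h0 hq hs hst htT)
    rw [← mul_sub]
    refine (le_abs_self _).trans ?_
    rw [abs_mul, he, one_mul]
  have hroot : (∫ x in (0 : ℝ)..1, |ux x s| ^ q) ^ (1 / q)
      ≤ ((∫ x in (0 : ℝ)..1, H₁ (ux x s)) / C₁ + C₂) ^ (1 / q) :=
    Real.rpow_le_rpow (intervalIntegral.integral_nonneg zero_le_one fun _ _ => by positivity)
      (hle s hsI) (by positivity)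
  refine le_trans ?_ (key.trans (hmean.trans hroot))
  refine mul_le_mul_of_nonneg_left ?_ (sub_nonneg.2 (hstr s ⟨le_rfl, hst⟩).2)
  linarith

end IsClassicalSolution

/-- Let `q > 1`, `T > 0`, `ξ ∈ C¹([0,T])`, `F ∈ C¹(ℝ)` non-decreasing,
and let `H₁, H₂ ∈ C²(ℝ)` be convex with `H := H₁ - H₂` satisfying `H 0 = 0`,
`H ≥ α H₁` for some `α ∈ (0,1]`, and `H₁ p ≥ C₁(|p|^q - C₂)` for all `p`, for some
`C₁ > 0`, `C₂ ≥ 0`. Let `u` be a classical solution of `du = ∂ₓ(F(∂ₓu)) dt + H(∂ₓu) dξ`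
on `𝕋 × [0,T]`. Then there exists a constant `C` depending only on `q` and `α` such
that, if `osc_{0,T}(ξ) > 0`, then
`‖∂ₓu(·,T)‖_{L^q(𝕋)} ≤ C ((C₁ osc_{0,T}(ξ))^{-1/(q-1)} + C₂^{1/q})`. -/
theorem gradient_Lq_decay_fluctuations (q α : ℝ) (hq : 1 < q)
    (hα : α ∈ Set.Ioc (0 : ℝ) 1) :
    ∃ C : ℝ, 0 < C ∧
      ∀ (T : ℝ), 0 < T →
      ∀ ξ : ℝ → ℝ, ContDiff ℝ 1 ξ →
      ∀ F : ℝ → ℝ, ContDiff ℝ 1 F → Monotone F →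
      ∀ H₁ H₂ : ℝ → ℝ, ContDiff ℝ 2 H₁ → ContDiff ℝ 2 H₂ →
        ConvexOn ℝ Set.univ H₁ → ConvexOn ℝ Set.univ H₂ →
        H₁ 0 - H₂ 0 = 0 →
        (∀ p : ℝ, α * H₁ p ≤ H₁ p - H₂ p) →
      ∀ C₁ C₂ : ℝ, 0 < C₁ → 0 ≤ C₂ →
        (∀ p : ℝ, C₁ * (|p| ^ q - C₂) ≤ H₁ p) →
      ∀ u ux uxx ut utx : ℝ → ℝ → ℝ,
        IsClassicalSolution (Set.Icc 0 T) ξ F (fun p => H₁ p - H₂ p) u ux uxx ut utx →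
        0 < oscOn ξ 0 T →
        (∫ x in (0 : ℝ)..1, |ux x T| ^ q) ^ (1 / q)
          ≤ C * ((C₁ * oscOn ξ 0 T) ^ (-(1 / (q - 1))) + C₂ ^ (1 / q)) := by
  obtain ⟨K, hK, hdecay⟩ := decay_of_stretch_inequality q α hq hα
  refine ⟨K ^ (1 / q), Real.rpow_pos_of_pos hK _, ?_⟩
  intro T hT ξ hξ F hF hFm H₁ H₂ hH₁ hH₂ hc₁ hc₂ h0 hαH C₁ C₂ hC₁ hC₂ hgrowth u ux uxx ut utx h hosc
  have hq0 : 0 < q := by linarith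
  have hcx : ∀ r ∈ Icc 0 T, Continuous fun x => ux x r :=
    fun r hr => continuous_slice_of_continuousOn_strip hr h.cont_ux
  have hle : ∀ t ∈ Icc 0 T,
      ∫ x in (0 : ℝ)..1, |ux x t| ^ q ≤ (∫ x in (0 : ℝ)..1, H₁ (ux x t)) / C₁ + C₂ := by
    intro t ht
    have h1 : IntervalIntegrable (fun x => |ux x t| ^ q) volume 0 1 :=
      ((hcx t ht).abs.rpow_const fun _ => Or.inr hq0.le).intervalIntegrable _ _
    have h2 : IntervalIntegrable (fun x => H₁ (ux x t) / C₁) volume 0 1 :=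
      ((hH₁.continuous.comp (hcx t ht)).div_const _).intervalIntegrable _ _
    have h3 := intervalIntegral.integral_mono_on (μ := volume) zero_le_one h1
      (h2.add (intervalIntegrable_const (c := C₂))) fun x _ => by
        have h4 : |ux x t| ^ q - C₂ ≤ H₁ (ux x t) / C₁ := by
          rw [le_div_iff₀ hC₁]
          linarith [hgrowth (ux x t)]
        linarith
    rw [intervalIntegral.integral_add h2 intervalIntegrable_const] at h3
    simpa using h3
  have hLq_nonneg : ∀ t, 0 ≤ ∫ x in (0 : ℝ)..1, |ux x t| ^ q :=
    fun t => intervalIntegral.integral_nonneg zero_le_one fun _ _ => by positivity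
  have hHc : Continuous fun p => H₁ p - H₂ p := hH₁.continuous.sub hH₂.continuous
  have hanti : AntitoneOn (fun t => (∫ x in (0 : ℝ)..1, H₁ (ux x t)) / C₁ + C₂) (Icc 0 T) :=
    fun s hs t ht hst => add_le_add_left (div_le_div_of_nonneg_right
      (h.antitoneOn_integral_comp_ux hT.le hF hFm hHc hH₁ hc₁ hs ht hst) hC₁.le) C₂
  have hcont : ContinuousOn (fun t => (∫ x in (0 : ℝ)..1, H₁ (ux x t)) / C₁ + C₂) (Icc 0 T) :=
    ((h.continuousOn_integral_comp_ux hT.le hH₁.continuous).div_const _).add continuousOn_const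
  have hne : (Icc 0 T).Nonempty := ⟨0, le_rfl, hT.le⟩
  obtain ⟨t₁, ht₁, hmin⟩ := isCompact_Icc.exists_isMinOn hne hξ.continuous.continuousOn
  obtain ⟨t₂, ht₂, hmax⟩ := isCompact_Icc.exists_isMaxOn hne hξ.continuous.continuousOn
  have hoscEq : oscOn ξ 0 T = ξ t₂ - ξ t₁ := by
    have h1 : IsGreatest (ξ '' Icc 0 T) (ξ t₂) :=
      ⟨mem_image_of_mem _ ht₂, forall_mem_image.2 fun r hr => hmax hr⟩
    have h2 : IsLeast (ξ '' Icc 0 T) (ξ t₁) :=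
      ⟨mem_image_of_mem _ ht₁, forall_mem_image.2 fun r hr => hmin hr⟩
    rw [oscOn, h1.csSup_eq, h2.csInf_eq]
  have hD : 0 < C₁ * oscOn ξ 0 T := mul_pos hC₁ hosc
  have horiented : ∀ e s₀ t₀, |e| = 1 → s₀ ∈ Icc 0 T → t₀ ∈ Icc 0 T → s₀ ≤ t₀ →
      e * C₁ * ξ t₀ - e * C₁ * ξ s₀ = C₁ * oscOn ξ 0 T →
      (∀ r ∈ Icc 0 T, e * C₁ * ξ s₀ ≤ e * C₁ * ξ r) →
      ∫ x in (0 : ℝ)..1, |ux x T| ^ q ≤ K * ((C₁ * oscOn ξ 0 T) ^ (-(q / (q - 1))) + C₂) := by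
    intro e s₀ t₀ he hs₀ ht₀ hst heq hmin'
    have hsub : Icc s₀ t₀ ⊆ Icc 0 T := Icc_subset_Icc hs₀.1 ht₀.2
    have h1 := hdecay (fun r => e * C₁ * ξ r)
      (fun t => (∫ x in (0 : ℝ)..1, H₁ (ux x t)) / C₁ + C₂) C₂ s₀ t₀ hC₂ hst
      (by linarith) (continuous_const.mul hξ.continuous).continuousOn (hcont.mono hsub)
      (hanti.mono hsub) (fun r hr => (hLq_nonneg r).trans (hle r (hsub hr)))
      (fun r hr => hmin' r (hsub hr))
      (fun s t hs hst' ht hstr => h.stretch_inequality hT.le hξ hF hFm hH₁ hH₂ hc₁ hc₂ h0 hαH hq hC₁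
        he hle (hs₀.1.trans hs) hst' (ht.trans ht₀.2) hstr)
    simp only [heq] at h1
    have hTI : T ∈ Icc 0 T := ⟨hT.le, le_rfl⟩
    exact (hle T hTI).trans ((hanti ht₀ hTI ht₀.2).trans h1)
  have hfinal : ∫ x in (0 : ℝ)..1, |ux x T| ^ q
      ≤ K * ((C₁ * oscOn ξ 0 T) ^ (-(q / (q - 1))) + C₂) := by
    rcases le_total t₁ t₂ with hle' | hle'
    · refine horiented 1 t₁ t₂ (by simp) ht₁ ht₂ hle' (by rw [hoscEq]; ring) fun r hr => ?_
      rw [one_mul]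
      exact mul_le_mul_of_nonneg_left (hmin hr) hC₁.le
    · refine horiented (-1) t₂ t₁ (by simp) ht₂ ht₁ hle' (by rw [hoscEq]; ring) fun r hr => ?_
      linarith [mul_le_mul_of_nonneg_left (show ξ r ≤ ξ t₂ from hmax hr) hC₁.le]
  have hpow_nonneg : 0 ≤ (C₁ * oscOn ξ 0 T) ^ (-(q / (q - 1))) := Real.rpow_nonneg hD.le _
  have hexp : -(q / (q - 1)) * (1 / q) = -(1 / (q - 1)) := by
    have : q - 1 ≠ 0 := by linarith
    field_simp
  calc (∫ x in (0 : ℝ)..1, |ux x T| ^ q) ^ (1 / q)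
      ≤ (K * ((C₁ * oscOn ξ 0 T) ^ (-(q / (q - 1))) + C₂)) ^ (1 / q) :=
        Real.rpow_le_rpow (hLq_nonneg T) hfinal (by positivity)
    _ = K ^ (1 / q) * ((C₁ * oscOn ξ 0 T) ^ (-(q / (q - 1))) + C₂) ^ (1 / q) :=
        Real.mul_rpow hK.le (by positivity)
    _ ≤ K ^ (1 / q) * (((C₁ * oscOn ξ 0 T) ^ (-(q / (q - 1)))) ^ (1 / q) + C₂ ^ (1 / q)) := by
        gcongr
        exact Real.rpow_add_le_add_rpow hpow_nonneg hC₂ (by positivity)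
          ((div_le_one hq0).2 hq.le)
    _ = _ := by rw [← Real.rpow_mul hD.le, hexp]
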